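/- Let ν ≥ 2, γ = (ν−2)/√(ν−1), and ε > 0. Let p, h : (−1,1) → ℝ be functions satisfying, for all x ∈ (−1,1), √(h(x) − p(x)²)/√(ν−1) ≤ p(x) + 1/(1+x) ≤ √(ν−1)·√(h(x) − p(x)²) and √(h(x) − p(x)²)/√(ν−1) ≤ −p(x) + 1/(1−x) ≤ √(ν−1)·√(h(x) − p(x)²). Suppose further that for every x₀ ∈ (−1,1) and every x ∈ (−1,1) with Hilbert distance d(x₀,x) < ε one has p₋(x) ≤ p(x) ≤ p₊(x), where p₋ and p₊ are the extremal solutions of p'' = 6p'p − 4p³ ∓/± 2γ(p' − p²)^{3/2} with initial conditions p±(x₀) = p(x₀), p±'(x₀) = h(x₀). Then p is continuously differentiable with p' = h, h is continuous, and for every x₀ ∈ (−1,1): limsup_{x→x₀} (h(x) − h(x₀))/(x − x₀) ≤ 6h(x₀)p(x₀) − 4p(x₀)³ + 2γ(h(x₀) − p(x₀)²)^{3/2} and liminf_{x→x₀} (h(x) − h(x₀))/(x − x₀) ≥ 6h(x₀)p(x₀) − 4p(x₀)³ − 2γ(h(x₀) − p(x₀)²)^{3/2}. -/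

import Mathlib

/-- Denominator of the extremal solution p₊. -/
noncomputable def denomPlus (γ x₀ p₀ g₀ x : ℝ) : ℝ :=
  -g₀ ^ 2 * (x - x₀) ^ 2 + (p₀ * (x - x₀) - 1) ^ 2 + γ * g₀ * (x - x₀) * (p₀ * (x - x₀) - 1)

/-- Denominator of the extremal solution p₋. -/
noncomputable def denomMinus (γ x₀ p₀ g₀ x : ℝ) : ℝ :=
  -g₀ ^ 2 * (x - x₀) ^ 2 + (p₀ * (x - x₀) - 1) ^ 2 - γ * g₀ * (x - x₀) * (p₀ * (x - x₀) - 1)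

/-- The extremal solution p₊ of p'' = 6p'p − 4p³ + 2γ(p'−p²)^{3/2} with
p(x₀) = p₀, p'(x₀) = h₀ = p₀² + g₀². -/
noncomputable def pPlus (γ x₀ p₀ g₀ x : ℝ) : ℝ :=
  (p₀ + (x - x₀) * (g₀ ^ 2 - p₀ ^ 2 - γ * g₀ * p₀)) / denomPlus γ x₀ p₀ g₀ x

/-- The extremal solution p₋ of p'' = 6p'p − 4p³ − 2γ(p'−p²)^{3/2} with
p(x₀) = p₀, p'(x₀) = h₀ = p₀² + g₀². -/
noncomputable def pMinus (γ x₀ p₀ g₀ x : ℝ) : ℝ :=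
  (p₀ + (x - x₀) * (g₀ ^ 2 - p₀ ^ 2 + γ * g₀ * p₀)) / denomMinus γ x₀ p₀ g₀ x
/-- The Hilbert distance on the interval (−1,1). -/
noncomputable def hilbertDist (a b : ℝ) : ℝ :=
  |Real.log (((1 + a) * (1 - b)) / ((1 - a) * (1 + b)))|

open Filter Topology

/-- The second derivative at `x₀` of the extremal solution `pPlus γ x₀ p₀ g₀`. -/
def secondJet (γ p₀ g₀ : ℝ) : ℝ := 2 * p₀ ^ 3 + 6 * p₀ * g₀ ^ 2 + 2 * γ * g₀ ^ 3

theorem pMinus_eq_pPlus_neg (γ x₀ p₀ g₀ x : ℝ) :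
    pMinus γ x₀ p₀ g₀ x = pPlus (-γ) x₀ p₀ g₀ x := by
  unfold pMinus pPlus denomMinus denomPlus
  congr 1 <;> ring

/-- Second-order Taylor expansion of `pPlus`, uniform for bounded parameters. -/
theorem exists_pPlus_taylor_bound (γ K : ℝ) :
    ∃ C : ℝ, ∃ δ : ℝ, 0 < δ ∧ ∀ y p₀ g₀ x : ℝ, |p₀| ≤ K → |g₀| ≤ K → |x - y| < δ →
      |pPlus γ y p₀ g₀ x
        - (p₀ + (p₀ ^ 2 + g₀ ^ 2) * (x - y) + secondJet γ p₀ g₀ / 2 * (x - y) ^ 2)|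
        ≤ C * |x - y| ^ 3 := by
  let a : ℝ × ℝ × ℝ → ℝ := fun q => 2 * q.1 + γ * q.2.1
  let b : ℝ × ℝ × ℝ → ℝ := fun q => q.1 ^ 2 - q.2.1 ^ 2 + γ * q.2.1 * q.1
  let c : ℝ × ℝ × ℝ → ℝ := fun q => secondJet γ q.1 q.2.1 / 2
  let s : Set (ℝ × ℝ × ℝ) := Set.Icc (-K) K ×ˢ Set.Icc (-K) K ×ˢ Set.Icc (-1) 1
  have hs : IsCompact s := isCompact_Icc.prod (isCompact_Icc.prod isCompact_Icc)
  obtain ⟨E, hE⟩ := hs.exists_bound_of_continuousOn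
    (f := fun q => - a q + b q * q.2.2) (by fun_prop)
  obtain ⟨C, hC⟩ := hs.exists_bound_of_continuousOn
    (f := fun q => - a q * c q + b q * (q.1 ^ 2 + q.2.1 ^ 2) + b q * c q * q.2.2)
    (by unfold c secondJet; fun_prop)
  refine ⟨2 * C, min 1 (1 / (2 * (|E| + 1))), by positivity, ?_⟩
  intro y p₀ g₀ x hp hg hx
  obtain ⟨hx1, hx2⟩ := lt_min_iff.1 hx
  have hmem : (p₀, g₀, x - y) ∈ s := ⟨abs_le.1 hp, abs_le.1 hg, abs_le.1 hx1.le⟩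
  have hE' := hE _ hmem
  have hC' := hC _ hmem
  simp only [a, b, c, Real.norm_eq_abs] at hE' hC'
  set t := x - y with ht
  set e := -(2 * p₀ + γ * g₀) + (p₀ ^ 2 - g₀ ^ 2 + γ * g₀ * p₀) * t with he
  have hD : denomPlus γ y p₀ g₀ x = 1 + t * e := by
    unfold denomPlus; rw [he, ht]; ring
  have hte : |t * e| ≤ 1 / 2 := by
    rw [abs_mul]
    have h1 : |e| ≤ |E| + 1 := by linarith [le_abs_self E]
    calc |t| * |e| ≤ (1 / (2 * (|E| + 1))) * (|E| + 1) := by gcongr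
      _ = 1 / 2 := by field_simp
  have hDpos : 1 / 2 ≤ denomPlus γ y p₀ g₀ x := by
    rw [hD]; linarith [(abs_le.1 hte).1]
  have hD0 : 0 < denomPlus γ y p₀ g₀ x := by linarith
  set R := -(2 * p₀ + γ * g₀) * (secondJet γ p₀ g₀ / 2)
      + (p₀ ^ 2 - g₀ ^ 2 + γ * g₀ * p₀) * (p₀ ^ 2 + g₀ ^ 2)
      + (p₀ ^ 2 - g₀ ^ 2 + γ * g₀ * p₀) * (secondJet γ p₀ g₀ / 2) * t with hR
  have hrem : pPlus γ y p₀ g₀ x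
      - (p₀ + (p₀ ^ 2 + g₀ ^ 2) * t + secondJet γ p₀ g₀ / 2 * t ^ 2)
      = -(t ^ 3 * R) / denomPlus γ y p₀ g₀ x := by
    rw [pPlus, div_sub' hD0.ne', ← ht]
    congr 1
    rw [hD, hR, he]
    unfold secondJet
    ring
  rw [hrem, abs_div, abs_neg, abs_mul, abs_pow, abs_of_pos hD0, div_le_iff₀ hD0]
  have hC0 : 0 ≤ C := (abs_nonneg _).trans hC'
  calc |t| ^ 3 * |R| ≤ |t| ^ 3 * C := by gcongr
    _ = 2 * C * |t| ^ 3 * (1 / 2) := by ring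
    _ ≤ _ := by gcongr

/-- The two-point form of the squeeze, near the diagonal. -/
theorem eventually_taylor_of_squeeze {γ K x₀ : ℝ} {p g : ℝ → ℝ}
    (hp : ∀ᶠ x in 𝓝 x₀, |p x| ≤ K) (hg : ∀ᶠ x in 𝓝 x₀, |g x| ≤ K)
    (hsq : ∀ᶠ q in 𝓝 (x₀, x₀), pMinus γ q.1 (p q.1) (g q.1) q.2 ≤ p q.2 ∧
      p q.2 ≤ pPlus γ q.1 (p q.1) (g q.1) q.2) :
    ∃ C : ℝ, ∀ᶠ q in 𝓝 (x₀, x₀),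
      secondJet (-γ) (p q.1) (g q.1) / 2 * (q.2 - q.1) ^ 2 - C * |q.2 - q.1| ^ 3
        ≤ p q.2 - p q.1 - (p q.1 ^ 2 + g q.1 ^ 2) * (q.2 - q.1) ∧
      p q.2 - p q.1 - (p q.1 ^ 2 + g q.1 ^ 2) * (q.2 - q.1)
        ≤ secondJet γ (p q.1) (g q.1) / 2 * (q.2 - q.1) ^ 2 + C * |q.2 - q.1| ^ 3 := by
  obtain ⟨C₁, δ₁, hδ₁, h₁⟩ := exists_pPlus_taylor_bound γ K
  obtain ⟨C₂, δ₂, hδ₂, h₂⟩ := exists_pPlus_taylor_bound (-γ) K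
  have hfst : Tendsto Prod.fst (𝓝 (x₀, x₀)) (𝓝 x₀) := continuous_fst.tendsto _
  have hclose : ∀ δ > 0, ∀ᶠ q in 𝓝 (x₀, x₀), |q.2 - q.1| < δ := by
    intro δ hδ
    have hcont : Continuous fun q : ℝ × ℝ => |q.2 - q.1| := by fun_prop
    exact hcont.tendsto (x₀, x₀) |>.eventually_lt_const (by simpa using hδ)
  refine ⟨max C₁ C₂, ?_⟩
  filter_upwards [hsq, hfst.eventually hp, hfst.eventually hg, hclose δ₁ hδ₁, hclose δ₂ hδ₂]
    with q hq hpq hgq hq₁ hq₂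
  have e₁ := abs_le.1 (h₁ q.1 (p q.1) (g q.1) q.2 hpq hgq hq₁)
  have e₂ := abs_le.1 (h₂ q.1 (p q.1) (g q.1) q.2 hpq hgq hq₂)
  rw [pMinus_eq_pPlus_neg] at hq
  have m₁ : C₁ * |q.2 - q.1| ^ 3 ≤ max C₁ C₂ * |q.2 - q.1| ^ 3 := by
    gcongr; exact le_max_left _ _
  have m₂ : C₂ * |q.2 - q.1| ^ 3 ≤ max C₁ C₂ * |q.2 - q.1| ^ 3 := by
    gcongr; exact le_max_right _ _
  constructor <;> linarith [e₁.1, e₁.2, e₂.1, e₂.2, hq.1, hq.2]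

theorem abs_secondJet_le {γ K p₀ g₀ : ℝ} (hp : |p₀| ≤ K) (hg : |g₀| ≤ K) :
    |secondJet γ p₀ g₀| ≤ (8 + 2 * |γ|) * K ^ 3 := by
  have hK : 0 ≤ K := (abs_nonneg _).trans hp
  unfold secondJet
  calc _ ≤ |2 * p₀ ^ 3| + |6 * p₀ * g₀ ^ 2| + |2 * γ * g₀ ^ 3| := abs_add_three _ _ _
    _ = 2 * |p₀| ^ 3 + 6 * |p₀| * |g₀| ^ 2 + 2 * |γ| * |g₀| ^ 3 := by
      simp [abs_mul, abs_pow]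
    _ ≤ 2 * K ^ 3 + 6 * K * K ^ 2 + 2 * |γ| * K ^ 3 := by gcongr
    _ = _ := by ring

/-- A function squeezed between the extremal solutions has derivative `p ^ 2 + g ^ 2`, which is
continuous and has difference quotients bounded by averages of second jets. -/
theorem hasDerivAt_and_quotient_bounds_of_squeeze {γ K x₀ : ℝ} {p g : ℝ → ℝ}
    (hp : ∀ᶠ x in 𝓝 x₀, |p x| ≤ K) (hg : ∀ᶠ x in 𝓝 x₀, |g x| ≤ K)
    (hsq : ∀ᶠ q in 𝓝 (x₀, x₀), pMinus γ q.1 (p q.1) (g q.1) q.2 ≤ p q.2 ∧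
      p q.2 ≤ pPlus γ q.1 (p q.1) (g q.1) q.2) :
    HasDerivAt p (p x₀ ^ 2 + g x₀ ^ 2) x₀ ∧
    ContinuousAt (fun x => p x ^ 2 + g x ^ 2) x₀ ∧
    ∃ C : ℝ, ∀ᶠ x in 𝓝[≠] x₀,
      (secondJet (-γ) (p x) (g x) + secondJet (-γ) (p x₀) (g x₀)) / 2 - C * |x - x₀|
        ≤ ((p x ^ 2 + g x ^ 2) - (p x₀ ^ 2 + g x₀ ^ 2)) / (x - x₀) ∧
      ((p x ^ 2 + g x ^ 2) - (p x₀ ^ 2 + g x₀ ^ 2)) / (x - x₀)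
        ≤ (secondJet γ (p x) (g x) + secondJet γ (p x₀) (g x₀)) / 2 + C * |x - x₀| := by
  obtain ⟨C, hC⟩ := eventually_taylor_of_squeeze hp hg hsq
  have hright : ∀ᶠ x in 𝓝 x₀, _ := (Continuous.prodMk_right x₀).tendsto x₀ |>.eventually hC
  have hleft : ∀ᶠ x in 𝓝 x₀, _ := (Continuous.prodMk_left x₀).tendsto x₀ |>.eventually hC
  have hnear : ∀ᶠ x in 𝓝 x₀, |x - x₀| < 1 := by
    have hcont : Continuous fun x : ℝ => |x - x₀| := by fun_prop
    exact hcont.tendsto x₀ |>.eventually_lt_const (by simp)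
  have hquot : ∀ᶠ x in 𝓝[≠] x₀,
      (secondJet (-γ) (p x) (g x) + secondJet (-γ) (p x₀) (g x₀)) / 2 - 2 * C * |x - x₀|
        ≤ ((p x ^ 2 + g x ^ 2) - (p x₀ ^ 2 + g x₀ ^ 2)) / (x - x₀) ∧
      ((p x ^ 2 + g x ^ 2) - (p x₀ ^ 2 + g x₀ ^ 2)) / (x - x₀)
        ≤ (secondJet γ (p x) (g x) + secondJet γ (p x₀) (g x₀)) / 2 + 2 * C * |x - x₀| := by
    filter_upwards [hright.filter_mono nhdsWithin_le_nhds,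
      hleft.filter_mono nhdsWithin_le_nhds, self_mem_nhdsWithin] with x hr hl hx
    have hx' : x - x₀ ≠ 0 := sub_ne_zero.2 hx
    have hpos : 0 < (x - x₀) ^ 2 := by positivity
    rw [abs_sub_comm x₀ x] at hl
    have hcube : |x - x₀| ^ 3 = |x - x₀| * (x - x₀) ^ 2 := by rw [← sq_abs]; ring
    have hdiv : ((p x ^ 2 + g x ^ 2) - (p x₀ ^ 2 + g x₀ ^ 2)) / (x - x₀)
        = ((p x ^ 2 + g x ^ 2) - (p x₀ ^ 2 + g x₀ ^ 2)) * (x - x₀) / (x - x₀) ^ 2 := by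
      field_simp
    rw [hcube] at hr hl
    rw [hdiv, le_div_iff₀ hpos, div_le_iff₀ hpos]
    constructor <;> linarith [hr.1, hr.2, hl.1, hl.2]
  have hp₀ := hp.self_of_nhds
  have hg₀ := hg.self_of_nhds
  set M := (8 + 2 * |γ|) * K ^ 3 with hM
  have hjet : ∀ {p₀ g₀ : ℝ}, |p₀| ≤ K → |g₀| ≤ K →
      |secondJet γ p₀ g₀| ≤ M ∧ |secondJet (-γ) p₀ g₀| ≤ M := fun h₁ h₂ =>
    ⟨abs_secondJet_le h₁ h₂, by simpa [hM] using abs_secondJet_le (γ := -γ) h₁ h₂⟩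
  have hCt : ∀ {t : ℝ}, |t| < 1 → C * |t| ≤ |C| := fun {t} ht =>
    (mul_le_mul_of_nonneg_right (le_abs_self C) (abs_nonneg t)).trans
      (mul_le_of_le_one_right (abs_nonneg C) ht.le)
  refine ⟨?_, ?_, 2 * C, hquot⟩
  · rw [hasDerivAt_iff_isLittleO]
    have hO : (fun x => p x - p x₀ - (x - x₀) • (p x₀ ^ 2 + g x₀ ^ 2))
        =O[𝓝 x₀] fun x => (x - x₀) ^ 2 := by
      refine Asymptotics.IsBigO.of_bound (M + |C|) ?_
      filter_upwards [hright, hnear] with x hr hx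
      have hcube : |x - x₀| ^ 3 = |x - x₀| * (x - x₀) ^ 2 := by rw [← sq_abs]; ring
      rw [hcube] at hr
      obtain ⟨j₁, j₂⟩ := hjet hp₀ hg₀
      have j₁' := (abs_le.1 j₁).2
      have j₂' := (abs_le.1 j₂).1
      have hM0 : 0 ≤ M := (abs_nonneg _).trans j₁
      have hsq0 := sq_nonneg (x - x₀)
      have k := mul_le_mul_of_nonneg_right (hCt hx) hsq0
      have k₁ := mul_le_mul_of_nonneg_right j₁' hsq0
      have k₂ := mul_le_mul_of_nonneg_right j₂' hsq0
      have k₃ := mul_nonneg hM0 hsq0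
      rw [Real.norm_eq_abs, Real.norm_eq_abs, abs_of_nonneg hsq0, abs_le, smul_eq_mul]
      constructor <;> linarith [hr.1, hr.2]
    refine hO.trans_isLittleO ?_
    have hid : Tendsto (fun x => x - x₀) (𝓝 x₀) (𝓝 0) := by
      have : Continuous fun x : ℝ => x - x₀ := by fun_prop
      simpa using this.tendsto x₀
    simpa [Function.comp_def] using
      (Asymptotics.isLittleO_pow_id (𝕜 := ℝ) one_lt_two).comp_tendsto hid
  · have hlip : ∀ᶠ x in 𝓝 x₀,
        |(p x ^ 2 + g x ^ 2) - (p x₀ ^ 2 + g x₀ ^ 2)| ≤ (M + 2 * |C|) * |x - x₀| := by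
      filter_upwards [eventually_nhdsWithin_iff.1 hquot, hp, hg, hnear] with x hq hpx hgx hx
      rcases eq_or_ne x x₀ with rfl | hne
      · simp
      have hq := hq hne
      have hx' : 0 < |x - x₀| := abs_pos.2 (sub_ne_zero.2 hne)
      rw [← div_le_iff₀ hx', ← abs_div, abs_le]
      obtain ⟨j₁, j₂⟩ := hjet hp₀ hg₀
      obtain ⟨l₁, l₂⟩ := hjet hpx hgx
      have := hCt hx
      constructor <;>
        linarith [hq.1, hq.2, (abs_le.1 j₁).2, (abs_le.1 j₂).1, (abs_le.1 l₁).2, (abs_le.1 l₂).1]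
    rw [ContinuousAt, tendsto_iff_norm_sub_tendsto_zero]
    refine squeeze_zero' (Eventually.of_forall fun _ => norm_nonneg _) hlip ?_
    have hcont : Continuous fun x : ℝ => (M + 2 * |C|) * |x - x₀| := by fun_prop
    simpa using hcont.tendsto x₀

theorem limsup_le_and_le_liminf_of_tendsto {α : Type*} {l : Filter α} [l.NeBot]
    {f u v : α → ℝ} {a b : ℝ} (hu : Tendsto u l (𝓝 a)) (hv : Tendsto v l (𝓝 b))
    (huf : ∀ᶠ x in l, u x ≤ f x) (hfv : ∀ᶠ x in l, f x ≤ v x) :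
    limsup f l ≤ b ∧ a ≤ liminf f l := by
  have hb : IsBoundedUnder (· ≤ ·) l f := hv.isBoundedUnder_le.mono_le hfv
  have ha : IsBoundedUnder (· ≥ ·) l f := hu.isBoundedUnder_ge.mono_ge huf
  exact ⟨hv.limsup_eq ▸ limsup_le_limsup hfv ha.isCoboundedUnder_le hv.isBoundedUnder_le,
    hu.liminf_eq ▸ liminf_le_liminf huf hu.isBoundedUnder_ge hb.isCoboundedUnder_ge⟩

theorem eventually_hilbertDist_lt {x₀ ε : ℝ} (hx₀ : x₀ ∈ Set.Ioo (-1 : ℝ) 1) (hε : 0 < ε) :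
    ∀ᶠ q in 𝓝 (x₀, x₀), hilbertDist q.1 q.2 < ε := by
  have h₁ : 0 < 1 + x₀ := by linarith [hx₀.1]
  have h₂ : 0 < 1 - x₀ := by linarith [hx₀.2]
  have hcont : ContinuousAt (fun q : ℝ × ℝ => hilbertDist q.1 q.2) (x₀, x₀) := by
    have hne : (1 - x₀) * (1 + x₀) ≠ 0 := (mul_pos h₂ h₁).ne'
    have hne' : (1 + x₀) * (1 - x₀) / ((1 - x₀) * (1 + x₀)) ≠ 0 :=
      (div_pos (mul_pos h₁ h₂) (mul_pos h₂ h₁)).ne'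
    unfold hilbertDist
    fun_prop (disch := assumption)
  refine hcont.eventually_lt_const ?_
  have : (1 + x₀) * (1 - x₀) / ((1 - x₀) * (1 + x₀)) = 1 := by field_simp
  simpa [hilbertDist, this] using hε

/-- Let p, h on (−1,1) satisfy the two chains of inequalities, and suppose
that for all x₀, x ∈ (−1,1) at Hilbert distance < ε the value p(x) is squeezed between the
extremal solutions p₋, p₊ issued from (p(x₀), h(x₀)) at x₀. Then p ∈ C¹ with p' = h, h is
continuous, and the difference quotients of h satisfy the ζ₋/ζ₊ bounds with
γ = (ν−2)/√(ν−1). -/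
theorem stmt_4 (ν : ℝ) (hν : 2 ≤ ν) (γ : ℝ) (hγ : γ = (ν - 2) / Real.sqrt (ν - 1))
    (ε : ℝ) (hε : 0 < ε) (p h : ℝ → ℝ)
    (hchain : ∀ x ∈ Set.Ioo (-1 : ℝ) 1,
      (Real.sqrt (h x - p x ^ 2) / Real.sqrt (ν - 1) ≤ p x + 1 / (1 + x) ∧
        p x + 1 / (1 + x) ≤ Real.sqrt (ν - 1) * Real.sqrt (h x - p x ^ 2)) ∧
      (Real.sqrt (h x - p x ^ 2) / Real.sqrt (ν - 1) ≤ -p x + 1 / (1 - x) ∧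
        -p x + 1 / (1 - x) ≤ Real.sqrt (ν - 1) * Real.sqrt (h x - p x ^ 2)))
    (hsqueeze : ∀ x₀ ∈ Set.Ioo (-1 : ℝ) 1, ∀ x ∈ Set.Ioo (-1 : ℝ) 1,
      hilbertDist x₀ x < ε →
        pMinus γ x₀ (p x₀) (Real.sqrt (h x₀ - p x₀ ^ 2)) x ≤ p x ∧
        p x ≤ pPlus γ x₀ (p x₀) (Real.sqrt (h x₀ - p x₀ ^ 2)) x) :
    (∀ x ∈ Set.Ioo (-1 : ℝ) 1, HasDerivAt p (h x) x) ∧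
    ContinuousOn h (Set.Ioo (-1 : ℝ) 1) ∧
    (∀ x₀ ∈ Set.Ioo (-1 : ℝ) 1,
      Filter.limsup (fun x => (h x - h x₀) / (x - x₀))
          (nhdsWithin x₀ (Set.Ioo (-1 : ℝ) 1 \ {x₀}))
        ≤ 6 * h x₀ * p x₀ - 4 * p x₀ ^ 3 + 2 * γ * (h x₀ - p x₀ ^ 2) ^ ((3 : ℝ) / 2) ∧
      6 * h x₀ * p x₀ - 4 * p x₀ ^ 3 - 2 * γ * (h x₀ - p x₀ ^ 2) ^ ((3 : ℝ) / 2)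
        ≤ Filter.liminf (fun x => (h x - h x₀) / (x - x₀))
          (nhdsWithin x₀ (Set.Ioo (-1 : ℝ) 1 \ {x₀}))) := by
  have hν1 : 1 ≤ Real.sqrt (ν - 1) := by
    rw [Real.one_le_sqrt]; linarith
  have hν0 : 0 < Real.sqrt (ν - 1) := by linarith
  set g : ℝ → ℝ := fun x => Real.sqrt (h x - p x ^ 2) with hgdef
  have hgpos : ∀ x ∈ Set.Ioo (-1 : ℝ) 1, 0 < g x := by
    intro x hx
    have h₁ : 0 < 1 / (1 + x) := one_div_pos.2 (by linarith [hx.1])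
    have h₂ : 0 < 1 / (1 - x) := one_div_pos.2 (by linarith [hx.2])
    obtain ⟨⟨-, hc₁⟩, ⟨-, hc₂⟩⟩ := hchain x hx
    have : 0 < Real.sqrt (ν - 1) * g x := by simp only [hgdef]; linarith
    exact pos_of_mul_pos_right this hν0.le
  have hh : ∀ x ∈ Set.Ioo (-1 : ℝ) 1, h x = p x ^ 2 + g x ^ 2 := by
    intro x hx
    have := Real.sq_sqrt (Real.sqrt_pos.1 (hgpos x hx)).le
    simp only [hgdef]; linarith
  have hnhds : ∀ x₀ ∈ Set.Ioo (-1 : ℝ) 1, ∀ᶠ x in 𝓝 x₀, x ∈ Set.Ioo (-1 : ℝ) 1 :=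
    fun x₀ hx₀ => isOpen_Ioo.mem_nhds hx₀
  have hbound : ∀ x₀ ∈ Set.Ioo (-1 : ℝ) 1, ∃ K : ℝ,
      (∀ᶠ x in 𝓝 x₀, |p x| ≤ K) ∧ ∀ᶠ x in 𝓝 x₀, |g x| ≤ K := by
    intro x₀ hx₀
    have hw₁ : ContinuousAt (fun x : ℝ => 1 / (1 + x)) x₀ :=
      continuousAt_const.div (by fun_prop) (by linarith [hx₀.1])
    have hw₂ : ContinuousAt (fun x : ℝ => 1 / (1 - x)) x₀ :=
      continuousAt_const.div (by fun_prop) (by linarith [hx₀.2])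
    set L := 1 / (1 + x₀) + 1 / (1 - x₀) + 1 with hL
    have hev := (hw₁.add hw₂).eventually_lt_const (show _ < L from lt_add_one _)
    have hall : ∀ᶠ x in 𝓝 x₀, |p x| ≤ Real.sqrt (ν - 1) * L ∧
        |g x| ≤ Real.sqrt (ν - 1) * L := by
      filter_upwards [hev, hnhds x₀ hx₀] with x hxL hx
      simp only [Pi.add_apply] at hxL
      have h₁ : 0 < 1 / (1 + x) := one_div_pos.2 (by linarith [hx.1])
      have h₂ : 0 < 1 / (1 - x) := one_div_pos.2 (by linarith [hx.2])
      obtain ⟨⟨hc₁, -⟩, ⟨hc₂, -⟩⟩ := hchain x hx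
      have hg0 : 0 < g x / Real.sqrt (ν - 1) := div_pos (hgpos x hx) hν0
      change g x / _ ≤ _ at hc₁ hc₂
      have hgL : g x / Real.sqrt (ν - 1) ≤ L := by linarith
      have hL0 : L ≤ Real.sqrt (ν - 1) * L := le_mul_of_one_le_left (by linarith) hν1
      refine ⟨abs_le.2 ⟨by linarith, by linarith⟩, ?_⟩
      rw [abs_of_pos (hgpos x hx), mul_comm]
      exact (div_le_iff₀ hν0).1 hgL
    exact ⟨_, hall.mono fun _ h => h.1, hall.mono fun _ h => h.2⟩
  choose K hp hg using hbound
  have hsq : ∀ x₀ ∈ Set.Ioo (-1 : ℝ) 1, ∀ᶠ q in 𝓝 (x₀, x₀),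
      pMinus γ q.1 (p q.1) (g q.1) q.2 ≤ p q.2 ∧ p q.2 ≤ pPlus γ q.1 (p q.1) (g q.1) q.2 := by
    intro x₀ hx₀
    filter_upwards [eventually_hilbertDist_lt hx₀ hε, (hnhds x₀ hx₀).prod_nhds (hnhds x₀ hx₀)]
      with q hq hqI
    exact hsqueeze q.1 hqI.1 q.2 hqI.2 hq
  have hmain := fun x₀ hx₀ => hasDerivAt_and_quotient_bounds_of_squeeze
    (hp x₀ hx₀) (hg x₀ hx₀) (hsq x₀ hx₀)
  have hheq : ∀ x₀ ∈ Set.Ioo (-1 : ℝ) 1, h =ᶠ[𝓝 x₀] fun x => p x ^ 2 + g x ^ 2 :=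
    fun x₀ hx₀ => (hnhds x₀ hx₀).mono hh
  have hcont : ∀ x₀ ∈ Set.Ioo (-1 : ℝ) 1, ContinuousAt h x₀ :=
    fun x₀ hx₀ => (hmain x₀ hx₀).2.1.congr (hheq x₀ hx₀).symm
  refine ⟨fun x hx => hh x hx ▸ (hmain x hx).1,
    fun x hx => (hcont x hx).continuousWithinAt, fun x₀ hx₀ => ?_⟩
  have hpc : ContinuousAt p x₀ := (hmain x₀ hx₀).1.continuousAt
  have hgc : ContinuousAt g x₀ := ((hcont x₀ hx₀).sub (hpc.pow 2)).sqrt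
  obtain ⟨-, -, C, hquot⟩ := hmain x₀ hx₀
  have hfilter : 𝓝[Set.Ioo (-1 : ℝ) 1 \ {x₀}] x₀ = 𝓝[≠] x₀ := by
    rw [Set.sdiff_eq, Set.inter_comm, nhdsWithin_inter_of_mem']
    exact mem_nhdsWithin_of_mem_nhds (isOpen_Ioo.mem_nhds hx₀)
  have hpow : (h x₀ - p x₀ ^ 2) ^ ((3 : ℝ) / 2) = g x₀ ^ 3 := by
    simp only [hgdef]
    rw [Real.sqrt_eq_rpow, ← Real.rpow_mul_natCast (Real.sqrt_pos.1 (hgpos x₀ hx₀)).le]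
    norm_num
  have hjet : ∀ c : ℝ, 6 * h x₀ * p x₀ - 4 * p x₀ ^ 3 + 2 * c * g x₀ ^ 3
      = secondJet c (p x₀) (g x₀) := by
    intro c; rw [hh x₀ hx₀, secondJet]; ring
  have hlim : ∀ c D : ℝ, Tendsto (fun x => (secondJet c (p x) (g x)
      + secondJet c (p x₀) (g x₀)) / 2 + D * |x - x₀|) (𝓝[≠] x₀)
      (𝓝 (secondJet c (p x₀) (g x₀))) := by
    intro c D
    have hc : ContinuousAt (fun x => (secondJet c (p x) (g x)
        + secondJet c (p x₀) (g x₀)) / 2 + D * |x - x₀|) x₀ := by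
      unfold secondJet; fun_prop
    simpa using hc.tendsto.mono_left nhdsWithin_le_nhds
  have hquot' : ∀ᶠ x in 𝓝[≠] x₀,
      (secondJet (-γ) (p x) (g x) + secondJet (-γ) (p x₀) (g x₀)) / 2 + -C * |x - x₀|
        ≤ (h x - h x₀) / (x - x₀) ∧
      (h x - h x₀) / (x - x₀)
        ≤ (secondJet γ (p x) (g x) + secondJet γ (p x₀) (g x₀)) / 2 + C * |x - x₀| := by
    filter_upwards [hquot, (hheq x₀ hx₀).filter_mono nhdsWithin_le_nhds] with x hq hx
    rw [hx, hh x₀ hx₀]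
    exact ⟨by linarith [hq.1], hq.2⟩
  rw [hfilter, hpow, hjet, show 6 * h x₀ * p x₀ - 4 * p x₀ ^ 3 - 2 * γ * g x₀ ^ 3
    = secondJet (-γ) (p x₀) (g x₀) by rw [← hjet]; ring]
  exact limsup_le_and_le_liminf_of_tendsto (hlim (-γ) (-C)) (hlim γ C)
    (hquot'.mono fun _ h => h.1) (hquot'.mono fun _ h => h.2)
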